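/- arXiv:2102.07078 — 5 statements merged into one kernel-verified Lean document; each statement's English description precedes it below -/
import Mathlib

section
/- Let n, d, N, k be positive integers and let 𝒜 : ℝ^{n×d} → ℝ^N be a linear map satisfying the 2k-restricted isometry property with constant δ_{2k} ∈ [0,1). Then for any n×d real matrices X and Y, each of rank at most k, |⟨𝒜(X), 𝒜(Y)⟩ − ⟨X, Y⟩| ≤ δ_{2k} · ‖X‖_F · ‖Y‖_F. -/
open Matrix MeasureTheory ProbabilityTheory
open scoped RealInnerProductSpace BigOperators

/-- Frobenius norm of a real matrix. -/
noncomputable def frobNorm {m n : ℕ} (M : Matrix (Fin m) (Fin n) ℝ) : ℝ :=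
  Real.sqrt (∑ i, ∑ j, M i j ^ 2)

/-- Spectral (ℓ²-operator) norm of a real matrix. -/
noncomputable def specNorm {m n : ℕ} (M : Matrix (Fin m) (Fin n) ℝ) : ℝ :=
  ‖LinearMap.toContinuousLinearMap (Matrix.toEuclideanLin M)‖

/-- Principal-angle distance between the column spans of two `d × k` matrices
with orthonormal columns: `dist(B, B*) = ‖B*ᵀ (B Bᵀ - I)‖₂`. -/
noncomputable def pdist {d k : ℕ} (B Bstar : Matrix (Fin d) (Fin k) ℝ) : ℝ :=
  specNorm (Bstarᵀ * (B * Bᵀ - 1))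

/-- The `k`-restricted isometry property with constant `δ` for a linear map from
`n × d` matrices to `ℝ^N`. -/
def RIP {n d N : ℕ} (A : Matrix (Fin n) (Fin d) ℝ →ₗ[ℝ] EuclideanSpace ℝ (Fin N))
    (k : ℕ) (δ : ℝ) : Prop :=
  ∀ M : Matrix (Fin n) (Fin d) ℝ, M.rank ≤ k →
    (1 - δ) * frobNorm M ^ 2 ≤ ‖A M‖ ^ 2 ∧ ‖A M‖ ^ 2 ≤ (1 + δ) * frobNorm M ^ 2

lemma frob_sq {m n : ℕ} (M : Matrix (Fin m) (Fin n) ℝ) :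
    frobNorm M ^ 2 = ∑ i, ∑ j, M i j ^ 2 := by
  unfold frobNorm
  exact Real.sq_sqrt (Finset.sum_nonneg fun i _ => Finset.sum_nonneg fun j _ => sq_nonneg _)

lemma tr_eq {m n : ℕ} (X Y : Matrix (Fin m) (Fin n) ℝ) :
    Matrix.trace (Xᵀ * Y) = ∑ i, ∑ j, X i j * Y i j := by
  simp only [Matrix.trace, Matrix.diag, Matrix.mul_apply, Matrix.transpose_apply]
  exact Finset.sum_comm

lemma frob_comb {m n : ℕ} (X Y : Matrix (Fin m) (Fin n) ℝ) (a b : ℝ) :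
    frobNorm (a • X + b • Y) ^ 2 = a ^ 2 * frobNorm X ^ 2 + 2 * a * b * Matrix.trace (Xᵀ * Y)
      + b ^ 2 * frobNorm Y ^ 2 := by
  simp only [frob_sq, tr_eq, Finset.mul_sum, ← Finset.sum_add_distrib]
  refine Finset.sum_congr rfl fun i _ => Finset.sum_congr rfl fun j _ => ?_
  simp only [Matrix.add_apply, Matrix.smul_apply, smul_eq_mul]
  ring

lemma frob_zero {m n : ℕ} (X : Matrix (Fin m) (Fin n) ℝ) (h : frobNorm X = 0) : X = 0 := by
  have h2 := frob_sq X
  rw [h] at h2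
  have h3 : ∑ i, ∑ j, X i j ^ 2 = 0 := by rw [← h2]; norm_num
  ext i j
  have h4 := (Finset.sum_eq_zero_iff_of_nonneg
    (fun i _ => Finset.sum_nonneg fun j _ => sq_nonneg (X i j))).1 h3 i (Finset.mem_univ _)
  have h5 := (Finset.sum_eq_zero_iff_of_nonneg
    (fun j _ => sq_nonneg (X i j))).1 h4 j (Finset.mem_univ _)
  simpa using h5

lemma rank_smul_le' {m n : ℕ} (X : Matrix (Fin m) (Fin n) ℝ) (a : ℝ) :
    (a • X).rank ≤ X.rank := by
  have : a • X = X * (a • (1 : Matrix (Fin n) (Fin n) ℝ)) := by simp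
  rw [this]
  exact Matrix.rank_mul_le_left _ _

lemma norm_comb {E : Type*} [NormedAddCommGroup E] [InnerProductSpace ℝ E] (x y : E) (a b : ℝ) :
    ‖a • x + b • y‖ ^ 2 = a ^ 2 * ‖x‖ ^ 2 + 2 * a * b * ⟪x, y⟫ + b ^ 2 * ‖y‖ ^ 2 := by
  rw [norm_add_sq_real, norm_smul, norm_smul, real_inner_smul_left, real_inner_smul_right,
    mul_pow, mul_pow, Real.norm_eq_abs, Real.norm_eq_abs, sq_abs, sq_abs]
  ring

lemma rank_add_le' {m n : ℕ} (X Y : Matrix (Fin m) (Fin n) ℝ) :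
    (X + Y).rank ≤ X.rank + Y.rank := by
  unfold Matrix.rank
  rw [Matrix.mulVecLin_add]
  refine (Submodule.finrank_mono (LinearMap.range_add_le _ _)).trans ?_
  exact Submodule.finrank_add_le_finrank_add_finrank _ _

theorem stmt0 {n d N k : ℕ} (hn : 0 < n) (hd : 0 < d) (hN : 0 < N) (hk : 0 < k)
    (A : Matrix (Fin n) (Fin d) ℝ →ₗ[ℝ] EuclideanSpace ℝ (Fin N))
    (δ : ℝ) (hδ0 : 0 ≤ δ) (hδ1 : δ < 1) (hRIP : RIP A (2 * k) δ)
    (X Y : Matrix (Fin n) (Fin d) ℝ) (hX : X.rank ≤ k) (hY : Y.rank ≤ k) :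
    abs (⟪A X, A Y⟫ - Matrix.trace (Xᵀ * Y)) ≤ δ * frobNorm X * frobNorm Y := by
  have hx0 : 0 ≤ frobNorm X := Real.sqrt_nonneg _
  have hy0 : 0 ≤ frobNorm Y := Real.sqrt_nonneg _
  rcases hx0.eq_or_lt with hx | hx
  · rw [frob_zero X hx.symm] at *
    simp [← hx]
  rcases hy0.eq_or_lt with hy | hy
  · rw [frob_zero Y hy.symm] at *
    simp [← hy]
  have key : ∀ a b : ℝ, (a • X + b • Y).rank ≤ 2 * k := fun a b => by
    have h1 := rank_add_le' (a • X) (b • Y)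
    have h2 := rank_smul_le' X a
    have h3 := rank_smul_le' Y b
    omega
  obtain ⟨p1, p2⟩ := hRIP _ (key (frobNorm Y) (frobNorm X))
  obtain ⟨q1, q2⟩ := hRIP _ (key (frobNorm Y) (-frobNorm X))
  rw [map_add, map_smul, map_smul, norm_comb, frob_comb] at p1 p2 q1 q2
  have hxy : 0 < frobNorm X * frobNorm Y := mul_pos hx hy
  rw [abs_le]
  constructor
  · refine le_of_mul_le_mul_left ?_ hxy
    nlinarith
  · refine le_of_mul_le_mul_left ?_ hxy
    nlinarith
end

section
/- Let d be a positive integer, m > 0, and let x be a random vector in ℝ^d whose coordinates are independent Gaussian random variables with mean 0 and variance 1/m. Let u, v ∈ ℝ^d be unit vectors. Then E[ ( ⟨x,u⟩² · ⟨u,v⟩ − ⟨x,u⟩ · ⟨x,v⟩ )² ] = (1/m²) · (1 − ⟨u,v⟩²). -/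
open Matrix MeasureTheory ProbabilityTheory
open scoped RealInnerProductSpace BigOperators

theorem stmt7 {Ω : Type*} [MeasurableSpace Ω] (μ : Measure Ω) [IsProbabilityMeasure μ]
    {d : ℕ} (hd : 0 < d) (m : ℝ) (hm : 0 < m)
    (x : Ω → EuclideanSpace ℝ (Fin d))
    (hmeas : ∀ i, Measurable fun ω => x ω i)
    (hindep : iIndepFun (fun i ω => x ω i) μ)
    (hgauss : ∀ i, μ.map (fun ω => x ω i) = gaussianReal 0 (Real.toNNReal (1 / m)))
    (u v : EuclideanSpace ℝ (Fin d)) (hu : ‖u‖ = 1) (hv : ‖v‖ = 1) :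
    ∫ ω, (⟪x ω, u⟫ ^ 2 * ⟪u, v⟫ - ⟪x ω, u⟫ * ⟪x ω, v⟫) ^ 2 ∂μ =
      (1 / m ^ 2) * (1 - ⟪u, v⟫ ^ 2) := by
  have hml : ∀ i, HasLaw (fun ω => x ω i) (gaussianReal 0 (Real.toNNReal (1 / m))) μ :=
    fun i => ⟨(hmeas i).aemeasurable, hgauss i⟩
  have hG : ∀ i, HasGaussianLaw (fun ω => x ω i) μ := fun i => (hml i).hasGaussianLaw
  have hJ : HasGaussianLaw (fun ω => ((fun i => x ω i) : Fin d → ℝ)) μ :=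
    iIndepFun.hasGaussianLaw (X := fun i ω => x ω i) hG hindep
  have hmean : ∀ i, ∫ ω, x ω i ∂μ = 0 := by
    intro i
    have h := (hml i).integral_eq
    simpa using h
  have hvar : ∀ i, cov[fun ω => x ω i, fun ω => x ω i; μ] = 1 / m := by
    intro i
    rw [covariance_self (hmeas i).aemeasurable]
    have h := (hml i).variance_eq
    rw [h, variance_id_gaussianReal, Real.coe_toNNReal _ (by positivity)]
  have hcov : ∀ i j, cov[fun ω => x ω i, fun ω => x ω j; μ] = if i = j then 1 / m else 0 := by
    intro i j
    split_ifs with h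
    · subst h; exact hvar i
    · exact (hindep.indepFun h).covariance_eq_zero (hG i).memLp_two (hG j).memLp_two
  have hinn : ∀ a : EuclideanSpace ℝ (Fin d), ∀ ω, ⟪x ω, a⟫ = ∑ i, a i * x ω i := by
    intro a ω
    simp [PiLp.inner_apply]
  have hmeanL : ∀ a : EuclideanSpace ℝ (Fin d), ∫ ω, ⟪x ω, a⟫ ∂μ = 0 := by
    intro a
    simp_rw [hinn]
    rw [integral_finsetSum _ (fun i _ => (hG i).integrable.const_mul _)]
    simp [integral_const_mul, hmean]
  have hcovL : ∀ a b : EuclideanSpace ℝ (Fin d),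
      cov[fun ω => ⟪x ω, a⟫, fun ω => ⟪x ω, b⟫; μ] = ⟪a, b⟫ / m := by
    intro a b
    simp_rw [hinn]
    rw [covariance_fun_sum_fun_sum (fun i => (hG i).memLp_two.const_mul _)
      (fun i => (hG i).memLp_two.const_mul _)]
    simp_rw [covariance_const_mul_left, covariance_const_mul_right, hcov]
    simp [PiLp.inner_apply, div_eq_mul_inv]
    rw [Finset.sum_mul]
    refine Finset.sum_congr rfl fun i _ => by ring
  have hjoint : ∀ a b : EuclideanSpace ℝ (Fin d),
      HasGaussianLaw (fun ω => (⟪x ω, a⟫, ⟪x ω, b⟫)) μ := by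
    intro a b
    let L : EuclideanSpace ℝ (Fin d) → (Fin d → ℝ) →L[ℝ] ℝ := fun a =>
      ∑ i, a i • ContinuousLinearMap.proj i
    have h := hJ.map_fun ((L a).prod (L b))
    convert! h using 2 with ω
    simp [L, hinn]
  have hmem : ∀ a : EuclideanSpace ℝ (Fin d), MemLp (fun ω => ⟪x ω, a⟫) 2 μ :=
    fun a => (hjoint a a).fst.memLp_two
  have hsq : ∀ a : EuclideanSpace ℝ (Fin d), ∫ ω, ⟪x ω, a⟫ ^ 2 ∂μ = ⟪a, a⟫ / m := by
    intro a
    have h := covariance_eq_sub (hmem a) (hmem a)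
    rw [hcovL, hmeanL] at h
    rw [h]
    simp [pow_two]
  have huu : ⟪u, u⟫ = 1 := by rw [real_inner_self_eq_norm_sq, hu]; norm_num
  have hvv : ⟪v, v⟫ = 1 := by rw [real_inner_self_eq_norm_sq, hv]; norm_num
  set c : ℝ := ⟪u, v⟫ with hc
  have hw : ⟪u, c • u - v⟫ = 0 := by
    rw [inner_sub_right, inner_smul_right, huu, ← hc]; ring
  have hww : ⟪c • u - v, c • u - v⟫ = 1 - c ^ 2 := by
    rw [inner_sub_left, inner_smul_left, hw, inner_sub_right, inner_smul_right,
      real_inner_comm, ← hc, hvv]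
    simp; ring
  have hind : IndepFun (fun ω => ⟪x ω, u⟫) (fun ω => ⟪x ω, c • u - v⟫) μ :=
    (hjoint _ _).indepFun_of_covariance_eq_zero (by rw [hcovL, hw, zero_div])
  have hind2 : IndepFun (fun ω => ⟪x ω, u⟫ ^ 2) (fun ω => ⟪x ω, c • u - v⟫ ^ 2) μ :=
    hind.comp (φ := fun t : ℝ => t ^ 2) (ψ := fun t : ℝ => t ^ 2) (by fun_prop) (by fun_prop)
  have hEq : ∀ ω, (⟪x ω, u⟫ ^ 2 * c - ⟪x ω, u⟫ * ⟪x ω, v⟫) ^ 2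
      = ⟪x ω, u⟫ ^ 2 * ⟪x ω, c • u - v⟫ ^ 2 := by
    intro ω
    rw [inner_sub_right, inner_smul_right]; ring
  simp_rw [hEq]
  rw [hind2.integral_fun_mul_eq_mul_integral ((hmem _).aestronglyMeasurable.pow 2)
    ((hmem _).aestronglyMeasurable.pow 2), hsq, hsq, huu, hww]
  field_simp
end

section
/- For every δ ∈ (0,1) there exist constants c₁, c₂, c₃ > 0 (depending only on δ) such that the following holds. Let n, d, m, k be positive integers with k ≤ min(n,d), and for each i ∈ {1,…,n} let X_i be an m×d random matrix whose entries are independent Gaussian random variables with mean 0 and variance 1/m, the matrices X₁,…,X_n being mutually independent. If m ≥ c₁·k·log(d/k) + c₂·(d·k + log n), then with probability at least 1 − exp(−c₃·m), simultaneously for every n×d real matrix S of rank at most k with rows s₁, …, s_n ∈ ℝ^d: (1−δ)·‖S‖_F² ≤ Σ_{i=1}^n ‖X_i s_i‖₂² ≤ (1+δ)·‖S‖_F². -/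
open Matrix MeasureTheory ProbabilityTheory
open scoped RealInnerProductSpace BigOperators

lemma aux_net (d : ℕ) : ∃ N : Finset (EuclideanSpace ℝ (Fin d)), N.card ≤ 5 ^ d ∧
    (∀ y ∈ N, ‖y‖ = 1) ∧ ∀ x : EuclideanSpace ℝ (Fin d), ‖x‖ = 1 → ∃ y ∈ N, ‖x - y‖ ≤ 1 / 2 := by
  classical
  let P : Finset (EuclideanSpace ℝ (Fin d)) → Prop := fun s =>
    (∀ y ∈ s, ‖y‖ = 1) ∧ ∀ a ∈ s, ∀ b ∈ s, a ≠ b → 1 / 2 ≤ ‖a - b‖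
  have hcard : ∀ s, P s → s.card ≤ 5 ^ d := by
    intro s hs
    have hinj : Function.Injective (fun x : EuclideanSpace ℝ (Fin d) => (2 : ℝ) • x) :=
      smul_right_injective _ two_ne_zero
    have := Besicovitch.card_le_of_separated (s.image (fun x => (2 : ℝ) • x)) (by
      intro c hc
      obtain ⟨y, hy, rfl⟩ := Finset.mem_image.1 hc
      rw [norm_smul, hs.1 y hy]; norm_num) (by
      intro a ha b hb hab
      obtain ⟨x, hx, rfl⟩ := Finset.mem_image.1 ha
      obtain ⟨y, hy, rfl⟩ := Finset.mem_image.1 hb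
      have hxy : x ≠ y := fun h => hab (by rw [h])
      have := hs.2 x hx y hy hxy
      rw [← smul_sub, norm_smul]
      norm_num
      linarith)
    rw [Finset.card_image_of_injective _ hinj] at this
    simpa using this
  let Q : ℕ → Prop := fun t => ∃ s, P s ∧ s.card = t
  have h0 : Q 0 := ⟨∅, ⟨by simp, by simp⟩, rfl⟩
  obtain ⟨s, hs, hsc⟩ : Q (Nat.findGreatest Q (5 ^ d)) := Nat.findGreatest_spec (Nat.zero_le _) h0
  refine ⟨s, hcard s hs, hs.1, fun x hx => ?_⟩
  by_contra! hcon
  have hxs : x ∉ s := fun h => by have := hcon x h; norm_num at this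
  have hP : P (insert x s) := by
    constructor
    · intro y hy
      rcases Finset.mem_insert.1 hy with rfl | hy
      · exact hx
      · exact hs.1 y hy
    · intro a ha b hb hab
      rcases Finset.mem_insert.1 ha with ha1 | ha1 <;> rcases Finset.mem_insert.1 hb with hb1 | hb1
      · exact absurd (ha1.trans hb1.symm) hab
      · rw [ha1]; exact (hcon b hb1).le
      · rw [hb1, norm_sub_rev]; exact (hcon a ha1).le
      · exact hs.2 a ha1 b hb1 hab
  have h1 : (insert x s).card ≤ Nat.findGreatest Q (5 ^ d) :=
    Nat.le_findGreatest (hcard _ hP) ⟨_, hP, rfl⟩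
  rw [Finset.card_insert_of_notMem hxs] at h1
  omega

/-- from net to sphere -/
lemma aux_ext (d m : ℕ) (N : Finset (EuclideanSpace ℝ (Fin d))) (hN : ∀ y ∈ N, ‖y‖ = 1)
    (hcov : ∀ x : EuclideanSpace ℝ (Fin d), ‖x‖ = 1 → ∃ y ∈ N, ‖x - y‖ ≤ 1 / 2)
    (A : Matrix (Fin m) (Fin d) ℝ) (η : ℝ)
    (h : ∀ y ∈ N, |∑ j, (A.mulVec y.ofLp) j ^ 2 - 1| ≤ η) (s : Fin d → ℝ) :
    |∑ j, (A.mulVec s) j ^ 2 - ∑ l, s l ^ 2| ≤ 32 * η * ∑ l, s l ^ 2 := by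
  let q : EuclideanSpace ℝ (Fin d) → ℝ := fun x => ∑ j, (A.mulVec x.ofLp) j ^ 2 - ‖x‖ ^ 2
  have hsm : ∀ (c : ℝ) x, q (c • x) = c ^ 2 * q x := by
    intro c x
    simp only [q, WithLp.ofLp_smul, Matrix.mulVec_smul, norm_smul, mul_pow, Pi.smul_apply,
      smul_eq_mul, ← Finset.mul_sum, Real.norm_eq_abs, sq_abs]
    ring
  have hid : ∀ x y, q ((5 : ℝ) • x - (3 : ℝ) • y) - q ((3 : ℝ) • x - (5 : ℝ) • y)
      = 16 * (q x - q y) := by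
    intro x y
    have e1 : ‖(5 : ℝ) • x - (3 : ℝ) • y‖ ^ 2 - ‖(3 : ℝ) • x - (5 : ℝ) • y‖ ^ 2
        = 16 * (‖x‖ ^ 2 - ‖y‖ ^ 2) := by
      rw [@norm_sub_sq_real, @norm_sub_sq_real]
      simp only [norm_smul, inner_smul_left, inner_smul_right]
      norm_num
      ring
    have e2 : ∑ j, (A.mulVec ((5 : ℝ) • x - (3 : ℝ) • y).ofLp) j ^ 2
        - ∑ j, (A.mulVec ((3 : ℝ) • x - (5 : ℝ) • y).ofLp) j ^ 2
        = 16 * (∑ j, (A.mulVec x.ofLp) j ^ 2 - ∑ j, (A.mulVec y.ofLp) j ^ 2) := by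
      rw [← Finset.sum_sub_distrib, ← Finset.sum_sub_distrib, Finset.mul_sum]
      refine Finset.sum_congr rfl fun j _ => ?_
      simp only [WithLp.ofLp_sub, WithLp.ofLp_smul, Matrix.mulVec_sub, Matrix.mulVec_smul,
        Pi.sub_apply, Pi.smul_apply, smul_eq_mul]
      ring
    simp only [q]
    linarith
  have hqc : Continuous q := by
    simp only [q, Matrix.mulVec, dotProduct]
    fun_prop
  have key : ∀ x, ‖x‖ = 1 → |q x| ≤ 32 * η := by
    intro x hx
    obtain ⟨x0, hx0, hmax⟩ := (isCompact_sphere (0 : EuclideanSpace ℝ (Fin d)) 1).exists_isMaxOn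
      ⟨x, by simpa using hx⟩ hqc.abs.continuousOn
    have hx0' : ‖x0‖ = 1 := by simpa using hx0
    have hM : ∀ z, ‖z‖ = 1 → |q z| ≤ |q x0| := fun z hz => hmax (by simpa using hz)
    have hM' : ∀ z, |q z| ≤ |q x0| * ‖z‖ ^ 2 := by
      intro z
      by_cases hz : z = 0
      · subst hz
        simp [q]
      · have hz' : ‖z‖ ≠ 0 := norm_ne_zero_iff.2 hz
        have e : z = ‖z‖ • (‖z‖⁻¹ • z) := by rw [smul_smul, mul_inv_cancel₀ hz', one_smul]
        have := hM (‖z‖⁻¹ • z) (by rw [norm_smul]; simp [hz'])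
        calc |q z| = ‖z‖ ^ 2 * |q (‖z‖⁻¹ • z)| := by
              conv_lhs => rw [e, hsm]
              rw [abs_mul, abs_of_nonneg (sq_nonneg _)]
          _ ≤ _ := by rw [mul_comm]; gcongr
    obtain ⟨y, hy, hxy⟩ := hcov x0 hx0'
    have hy1 := hN y hy
    have hqy : |q y| ≤ η := by
      have := h y hy
      simp only [q, hy1]; simpa using this
    have hs : ‖x0 - y‖ ^ 2 ≤ 1 / 4 := by nlinarith [norm_nonneg (x0 - y)]
    have hn : ‖(5 : ℝ) • x0 - (3 : ℝ) • y‖ ^ 2 + ‖(3 : ℝ) • x0 - (5 : ℝ) • y‖ ^ 2 ≤ 31 / 2 := by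
      rw [@norm_sub_sq_real] at hs ⊢
      rw [@norm_sub_sq_real]
      simp only [norm_smul, inner_smul_left, inner_smul_right, hx0', hy1] at hs ⊢
      norm_num at hs ⊢
      linarith
    have h1 := hM' ((5 : ℝ) • x0 - (3 : ℝ) • y)
    have h2 := hM' ((3 : ℝ) • x0 - (5 : ℝ) • y)
    have h3 := hid x0 y
    have h4 : |q x0| ≤ |q y| + 31 / 32 * |q x0| := by
      have h5 : q x0 = q y + (q ((5 : ℝ) • x0 - (3 : ℝ) • y) - q ((3 : ℝ) • x0 - (5 : ℝ) • y)) / 16 := by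
        linarith
      have h6 : |q x0| ≤ |q y| + (|q ((5 : ℝ) • x0 - (3 : ℝ) • y)| + |q ((3 : ℝ) • x0 - (5 : ℝ) • y)|) / 16 := by
        conv_lhs => rw [h5]
        refine (abs_add_le _ _).trans ?_
        rw [abs_div, abs_of_pos (by norm_num : (0 : ℝ) < 16)]
        gcongr
        exact abs_sub _ _
      nlinarith [abs_nonneg (q x0)]
    have := hM x hx
    linarith
  set z : EuclideanSpace ℝ (Fin d) := WithLp.toLp 2 s with hzdef
  have hzn : ‖z‖ ^ 2 = ∑ l, s l ^ 2 := by
    rw [EuclideanSpace.norm_sq_eq]; simp [hzdef]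
  have hgoal : |q z| ≤ 32 * η * ‖z‖ ^ 2 := by
    by_cases hz : z = 0
    · rw [hz]; simp [q]
    · have hz' : ‖z‖ ≠ 0 := norm_ne_zero_iff.2 hz
      have e : z = ‖z‖ • (‖z‖⁻¹ • z) := by rw [smul_smul, mul_inv_cancel₀ hz', one_smul]
      have := key (‖z‖⁻¹ • z) (by rw [norm_smul]; simp [hz'])
      calc |q z| = ‖z‖ ^ 2 * |q (‖z‖⁻¹ • z)| := by
            conv_lhs => rw [e, hsm]
            rw [abs_mul, abs_of_nonneg (sq_nonneg _)]
        _ ≤ _ := by rw [mul_comm]; gcongr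
  rw [← hzn]
  exact hgoal

lemma aux_int (t : ℝ) (ht : |t| ≤ 1 / 4) :
    Integrable (fun z => Real.exp (t * (z ^ 2 - 1))) (gaussianReal 0 1) ∧
    ∫ z, Real.exp (t * (z ^ 2 - 1)) ∂(gaussianReal 0 1) ≤ Real.exp (4 * t ^ 2) := by
  have ht' := abs_le.1 ht
  have hpos : 0 < 1 - 2 * t := by linarith
  have hval : ∫ z, Real.exp (t * (z ^ 2 - 1)) ∂(gaussianReal 0 1)
      = Real.exp (-t) * (√(1 - 2 * t))⁻¹ := by
    rw [integral_gaussianReal_eq_integral_smul one_ne_zero]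
    have : ∀ x : ℝ, gaussianPDFReal 0 1 x • Real.exp (t * (x ^ 2 - 1))
        = ((√(2 * Real.pi))⁻¹ * Real.exp (-t)) * Real.exp (-(1 / 2 - t) * x ^ 2) := by
      intro x
      simp only [gaussianPDFReal, smul_eq_mul, NNReal.coe_one, mul_one, sub_zero]
      rw [mul_assoc, mul_assoc, ← Real.exp_add, ← Real.exp_add]
      congr 2
      ring
    simp_rw [this]
    rw [integral_const_mul, integral_gaussian]
    have e : Real.pi / (1 / 2 - t) = (2 * Real.pi) * (1 - 2 * t)⁻¹ := by
      have : (1 / 2 - t) ≠ 0 := by linarith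
      field_simp
    rw [e, Real.sqrt_mul (by positivity : 0 ≤ 2 * Real.pi) (1 - 2 * t)⁻¹, Real.sqrt_inv]
    have : √(2 * Real.pi) ≠ 0 := by positivity
    field_simp
  refine ⟨Integrable.of_integral_ne_zero ?_, ?_⟩
  · rw [hval]; positivity
  · rw [hval]
    have h1 := Real.abs_log_sub_add_sum_range_le (x := 2 * t) (by
      rw [abs_mul]; norm_num; linarith) 1
    simp at h1
    have h2 : |2 * t| ≤ 1 / 2 := by rw [abs_mul]; norm_num; linarith
    have h3 : |2 * t| ^ 2 / (1 - |2 * t|) ≤ 8 * t ^ 2 := by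
      rw [div_le_iff₀ (by linarith), sq_abs]
      nlinarith [sq_nonneg t]
    have h4 : -(2 * t) - 8 * t ^ 2 ≤ Real.log (1 - 2 * t) := by
      have := (abs_le.1 (h1.trans (by simpa using h3))).1
      linarith
    have h5 : √(1 - 2 * t) = Real.exp (Real.log (1 - 2 * t) / 2) := by
      rw [Real.exp_half, Real.exp_log hpos]
    rw [h5, ← Real.exp_neg, ← Real.exp_add]
    apply Real.exp_le_exp.2
    linarith

lemma aux_law {Ω : Type} [MeasurableSpace Ω] {μ : Measure Ω} [IsProbabilityMeasure μ] {d : ℕ}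
    (f : Fin d → Ω → ℝ) (hf : ∀ l, Measurable (f l)) (hi : iIndepFun f μ) (v : Fin d → NNReal)
    (hl : ∀ l, μ.map (f l) = gaussianReal 0 (v l)) (s : Finset (Fin d)) :
    μ.map (∑ l ∈ s, f l) = gaussianReal 0 (∑ l ∈ s, v l) := by
  classical
  induction s using Finset.induction_on with
  | empty =>
    simp only [Finset.sum_empty, gaussianReal_zero_var]
    change μ.map (fun _ => (0 : ℝ)) = _
    simp [Measure.map_const]
  | insert a s ha ih =>
    have := gaussianReal_add_gaussianReal_of_indepFun
      (hi.indepFun_finsetSum_of_notMem hf ha) ih (hl a)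
    rw [Finset.sum_insert ha, Finset.sum_insert ha, add_comm, this, add_zero, add_comm]

lemma aux_tail {Ω : Type} [MeasurableSpace Ω] {μ : Measure Ω} [IsProbabilityMeasure μ] {m : ℕ}
    (Z : Fin m → Ω → ℝ) (hZ : ∀ j, Measurable (Z j)) (hi : iIndepFun Z μ)
    (hl : ∀ j, μ.map (Z j) = gaussianReal 0 1) (η : ℝ) (h0 : 0 < η) (h1 : η ≤ 1) :
    μ.real {ω | m * η ≤ |∑ j, Z j ω ^ 2 - m|} ≤ 2 * Real.exp (-(η ^ 2 / 16) * m) := by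
  let W : Fin m → Ω → ℝ := fun j ω => Z j ω ^ 2 - 1
  have hW : ∀ j, Measurable (W j) := fun j => by fun_prop
  have hWi : iIndepFun W μ := hi.comp (fun _ z => z ^ 2 - 1) (fun _ => by fun_prop)
  have hWint : ∀ t : ℝ, |t| ≤ 1 / 4 → ∀ j, Integrable (fun ω => Real.exp (t * W j ω)) μ := by
    intro t ht j
    have := (aux_int t ht).1
    rw [← hl j] at this
    exact this.comp_measurable (hZ j)
  have hWm : ∀ t : ℝ, |t| ≤ 1 / 4 → ∀ j, mgf (W j) μ t ≤ Real.exp (4 * t ^ 2) := by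
    intro t ht j
    have := (aux_int t ht).2
    rw [← hl j, integral_map (hZ j).aemeasurable (by fun_prop)] at this
    exact this
  have hint : ∀ t : ℝ, |t| ≤ 1 / 4 → Integrable (fun ω => Real.exp (t * (∑ j, W j) ω)) μ :=
    fun t ht => hWi.integrable_exp_mul_sum hW (fun j _ => hWint t ht j)
  have hmgf : ∀ t : ℝ, |t| ≤ 1 / 4 → mgf (∑ j, W j) μ t ≤ Real.exp (4 * t ^ 2 * m) := by
    intro t ht
    rw [hWi.mgf_sum hW]
    calc ∏ j, mgf (W j) μ t ≤ ∏ j : Fin m, Real.exp (4 * t ^ 2) :=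
          Finset.prod_le_prod (fun _ _ => mgf_nonneg) (fun j _ => hWm t ht j)
      _ = _ := by rw [Finset.prod_const, ← Real.exp_nat_mul]; simp; ring
  have hsum : ∀ ω, (∑ j, W j) ω = ∑ j, Z j ω ^ 2 - m := by
    intro ω; simp [W]
  have ht1 : |η / 8| ≤ 1 / 4 := by rw [abs_of_pos (by linarith)]; linarith
  have ht2 : |-(η / 8)| ≤ 1 / 4 := by rwa [abs_neg]
  have hA := measure_ge_le_exp_mul_mgf (X := ∑ j, W j) (μ := μ) (m * η) (by linarith) (hint _ ht1)
  have hB := measure_le_le_exp_mul_mgf (X := ∑ j, W j) (μ := μ) (-(m * η)) (by linarith) (hint _ ht2)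
  have hA' : μ.real {ω | m * η ≤ (∑ j, W j) ω} ≤ Real.exp (-(η ^ 2 / 16) * m) := by
    refine hA.trans ((mul_le_mul_of_nonneg_left (hmgf _ ht1) (Real.exp_nonneg _)).trans ?_)
    rw [← Real.exp_add]; apply le_of_eq; congr 1; ring
  have hB' : μ.real {ω | (∑ j, W j) ω ≤ -(m * η)} ≤ Real.exp (-(η ^ 2 / 16) * m) := by
    refine hB.trans ((mul_le_mul_of_nonneg_left (hmgf _ ht2) (Real.exp_nonneg _)).trans ?_)
    rw [← Real.exp_add]; apply le_of_eq; congr 1; ring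
  have hsub : {ω | m * η ≤ |∑ j, Z j ω ^ 2 - m|} ⊆
      {ω | m * η ≤ (∑ j, W j) ω} ∪ {ω | (∑ j, W j) ω ≤ -(m * η)} := by
    intro ω hω
    simp only [Set.mem_ofPred_eq, Set.mem_union, hsum] at hω ⊢
    rcases le_abs.1 hω with h | h
    · exact Or.inl h
    · exact Or.inr (by linarith)
  have := (measureReal_mono (μ := μ) hsub (measure_ne_top _ _)).trans (measureReal_union_le _ _)
  linarith

lemma aux_rows {Ω : Type} [MeasurableSpace Ω] {μ : Measure Ω} [IsProbabilityMeasure μ] {m d : ℕ}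
    (F : Fin m × Fin d → Ω → ℝ) (hF : ∀ p, Measurable (F p)) (hi : iIndepFun F μ) (v : NNReal)
    (hl : ∀ p, μ.map (F p) = gaussianReal 0 v) :
    iIndepFun (fun (j : Fin m) ω (l : Fin d) => F (j, l) ω) μ := by
  have hg : ∀ p, HasGaussianLaw (F p) μ := fun p => ⟨by rw [hl p]; infer_instance⟩
  have hJ := hi.hasGaussianLaw hg
  have hJ2 := hJ.map_fun (ContinuousLinearMap.pi (fun j : Fin m => ContinuousLinearMap.pi
    (fun l : Fin d => ContinuousLinearMap.proj (R := ℝ) (φ := fun _ : Fin m × Fin d => ℝ) (j, l))))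
  refine HasGaussianLaw.iIndepFun_of_covariance_eval (X := fun j l => F (j, l)) hJ2 ?_
  intro i j hij k l
  exact (hi.indepFun (by simp [hij])).covariance_eq_zero (hg _).memLp_two (hg _).memLp_two

lemma aux_unit {Ω : Type} [MeasurableSpace Ω] {μ : Measure Ω} [IsProbabilityMeasure μ] {m d : ℕ}
    (hm : 0 < m) (A : Ω → Matrix (Fin m) (Fin d) ℝ) (hA : ∀ j l, Measurable (fun ω => A ω j l))
    (hi : iIndepFun (fun (p : Fin m × Fin d) ω => A ω p.1 p.2) μ)
    (hl : ∀ j l, μ.map (fun ω => A ω j l) = gaussianReal 0 (Real.toNNReal (1 / m)))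
    (η : ℝ) (h0 : 0 < η) (h1 : η ≤ 1) (y : Fin d → ℝ) (hy : ∑ l, y l ^ 2 = 1) :
    μ.real {ω | η ≤ |∑ j, ((A ω).mulVec y) j ^ 2 - 1|} ≤ 2 * Real.exp (-(η ^ 2 / 16) * m) := by
  have hm' : (0 : ℝ) < m := by exact_mod_cast hm
  let Z : Fin m → Ω → ℝ := fun j ω => √m * ((A ω).mulVec y) j
  have hZm : ∀ j, Measurable (Z j) := by
    intro j
    simp only [Z, Matrix.mulVec, dotProduct]
    fun_prop
  have hrows := aux_rows (fun p ω => A ω p.1 p.2) (fun p => hA _ _) hi _ (fun p => hl p.1 p.2)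
  have hZi : iIndepFun Z μ := hrows.comp (fun _ r => √m * ∑ l, r l * y l) (fun _ => by fun_prop)
  have hZl : ∀ j, μ.map (Z j) = gaussianReal 0 1 := by
    intro j
    have hrow : iIndepFun (fun l ω => A ω j l) μ :=
      hi.precomp (g := fun l : Fin d => (j, l)) (fun a b h => by simpa using h)
    have hf : iIndepFun (fun l ω => (√m * y l) * A ω j l) μ :=
      hrow.comp (fun l z => (√m * y l) * z) (fun _ => by fun_prop)
    have := aux_law (fun l ω => (√m * y l) * A ω j l) (fun l => by fun_prop) hf
      (fun l => Real.toNNReal (y l ^ 2)) (fun l => by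
        have e := gaussianReal_map_const_mul (μ := 0) (v := Real.toNNReal (1 / m)) (√m * y l)
        rw [← hl j l, Measure.map_map (by fun_prop) (hA j l)] at e
        refine Eq.trans e ?_
        rw [mul_zero]
        congr 1
        apply NNReal.eq
        simp only [NNReal.coe_mul, NNReal.coe_mk]
        rw [Real.coe_toNNReal _ (by positivity), Real.coe_toNNReal _ (by positivity), mul_pow,
          Real.sq_sqrt hm'.le]
        field_simp) Finset.univ
    have e1 : (∑ l, fun ω => (√m * y l) * A ω j l) = Z j := by
      ext ω
      simp only [Z, Matrix.mulVec, dotProduct, Finset.sum_apply, Finset.mul_sum]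
      refine Finset.sum_congr rfl fun l _ => by ring
    have e2 : ∑ l, Real.toNNReal (y l ^ 2) = 1 := by
      rw [← Real.toNNReal_sum_of_nonneg (fun _ _ => sq_nonneg _), hy, Real.toNNReal_one]
    rwa [e1, e2] at this
  refine le_trans (le_of_eq ?_) (aux_tail Z hZm hZi hZl η h0 h1)
  congr 1
  ext ω
  simp only [Set.mem_ofPred_eq]
  have : ∑ j, Z j ω ^ 2 - m = m * (∑ j, ((A ω).mulVec y) j ^ 2 - 1) := by
    simp only [Z, mul_pow, Real.sq_sqrt hm'.le, ← Finset.mul_sum]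
    ring
  rw [this, abs_mul, abs_of_pos hm', mul_le_mul_iff_right₀ hm']

theorem stmt9 (δ : ℝ) (hδ0 : 0 < δ) (hδ1 : δ < 1) :
    ∃ c₁ c₂ c₃ : ℝ, 0 < c₁ ∧ 0 < c₂ ∧ 0 < c₃ ∧
      ∀ (n d m k : ℕ), 0 < n → 0 < d → 0 < m → 0 < k → k ≤ n → k ≤ d →
      ∀ (Ω : Type) (_ : MeasurableSpace Ω) (μ : Measure Ω), IsProbabilityMeasure μ →
      ∀ X : Fin n → Ω → Matrix (Fin m) (Fin d) ℝ,
        (∀ i j l, Measurable (fun ω => X i ω j l)) →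
        iIndepFun
          (fun p : Fin n × Fin m × Fin d => fun ω => X p.1 ω p.2.1 p.2.2) μ →
        (∀ i j l, μ.map (fun ω => X i ω j l) = gaussianReal 0 (Real.toNNReal (1 / m))) →
        c₁ * k * Real.log (d / k) + c₂ * (d * k + Real.log n) ≤ m →
        ENNReal.ofReal (1 - Real.exp (-c₃ * m)) ≤
          μ {ω | ∀ S : Matrix (Fin n) (Fin d) ℝ, S.rank ≤ k →
            (1 - δ) * frobNorm S ^ 2 ≤ ∑ i, ∑ j, ((X i ω).mulVec (S i)) j ^ 2 ∧
            ∑ i, ∑ j, ((X i ω).mulVec (S i)) j ^ 2 ≤ (1 + δ) * frobNorm S ^ 2} := by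
  set η : ℝ := δ / 32 with hη
  have hη0 : 0 < η := by positivity
  have hη1 : η ≤ 1 := by rw [hη]; linarith
  refine ⟨1, 128 / η ^ 2, η ^ 2 / 32, one_pos, by positivity, by positivity, ?_⟩
  intro n d m k hn hd hm hk _ hkd Ω _ μ _ X hX hind hlaw hmm
  obtain ⟨N, hNc, hN1, hNcov⟩ := aux_net d
  have hnR : (1 : ℝ) ≤ n := by exact_mod_cast hn
  have hdR : (1 : ℝ) ≤ d := by exact_mod_cast hd
  have hkR : (1 : ℝ) ≤ k := by exact_mod_cast hk
  have hkdR : (k : ℝ) ≤ d := by exact_mod_cast hkd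
  let B : Fin n → EuclideanSpace ℝ (Fin d) → Set Ω := fun i y =>
    {ω | η ≤ |∑ j, ((X i ω).mulVec y.ofLp) j ^ 2 - 1|}
  have hBm : ∀ i y, MeasurableSet (B i y) := by
    intro i y
    refine measurableSet_le measurable_const ?_
    simp only [Matrix.mulVec, dotProduct]
    have := hX i
    fun_prop
  have hB : ∀ i, ∀ y ∈ N, μ.real (B i y) ≤ 2 * Real.exp (-(η ^ 2 / 16) * m) := by
    intro i y hy
    refine aux_unit hm (X i) (hX i) ?_ (hlaw i) η hη0 hη1 y.ofLp ?_
    · exact hind.precomp (g := fun p : Fin m × Fin d => (i, p)) (fun a b h => by simpa using h)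
    · have h1 := hN1 y hy
      have h2 := EuclideanSpace.norm_sq_eq y
      rw [h1] at h2
      simpa using h2.symm
  let Bad : Set Ω := ⋃ i ∈ (Finset.univ : Finset (Fin n)), ⋃ y ∈ N, B i y
  have hBadm : MeasurableSet Bad :=
    Finset.measurableSet_biUnion _ fun i _ => Finset.measurableSet_biUnion _ fun y _ => hBm i y
  have hBad : μ.real Bad ≤ Real.exp (-(η ^ 2 / 32) * m) := by
    have h1 : μ.real Bad ≤ n * (5 ^ d * (2 * Real.exp (-(η ^ 2 / 16) * m))) := by
      calc μ.real Bad ≤ ∑ i : Fin n, μ.real (⋃ y ∈ N, B i y) :=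
            measureReal_biUnion_finset_le _ _
        _ ≤ ∑ i : Fin n, (5 ^ d * (2 * Real.exp (-(η ^ 2 / 16) * m))) := by
            refine Finset.sum_le_sum fun i _ => ?_
            calc μ.real (⋃ y ∈ N, B i y) ≤ ∑ y ∈ N, μ.real (B i y) :=
                  measureReal_biUnion_finset_le _ _
              _ ≤ ∑ y ∈ N, (2 * Real.exp (-(η ^ 2 / 16) * m)) := Finset.sum_le_sum (hB i)
              _ = N.card * (2 * Real.exp (-(η ^ 2 / 16) * m)) := by
                  rw [Finset.sum_const, nsmul_eq_mul]
              _ ≤ _ := by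
                  gcongr
                  exact_mod_cast hNc
        _ = _ := by rw [Finset.sum_const, nsmul_eq_mul]; simp
    have hlog : 0 ≤ Real.log (d / k) := Real.log_nonneg (by
      rw [le_div_iff₀ (by linarith)]; linarith)
    have h2 : 128 * (d + Real.log n) ≤ η ^ 2 * m := by
      have h3 : 128 / η ^ 2 * (d + Real.log n) ≤ m := by
        refine le_trans ?_ hmm
        have : 128 / η ^ 2 * (d + Real.log n) ≤ 128 / η ^ 2 * (d * k + Real.log n) := by
          gcongr
          nlinarith
        have h4 : 0 ≤ 1 * (k : ℝ) * Real.log (d / k) := by positivity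
        linarith
      rw [div_mul_eq_mul_div, div_le_iff₀ (by positivity)] at h3
      linarith
    have h5 : (5 : ℝ) ^ d ≤ Real.exp (2 * d) := by
      rw [mul_comm, Real.exp_nat_mul]
      gcongr
      have h := Real.exp_one_gt_d9
      have : Real.exp 2 = Real.exp 1 * Real.exp 1 := by rw [← Real.exp_add]; norm_num
      rw [this]
      nlinarith
    have h6 : (2 : ℝ) ≤ Real.exp d := by
      have := Real.add_one_le_exp (d : ℝ)
      linarith
    have h7 : (n : ℝ) = Real.exp (Real.log n) := (Real.exp_log (by linarith)).symm
    calc μ.real Bad ≤ n * (5 ^ d * (2 * Real.exp (-(η ^ 2 / 16) * m))) := h1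
      _ ≤ Real.exp (Real.log n) * (Real.exp (2 * d) * (Real.exp d * Real.exp (-(η ^ 2 / 16) * m))) := by
          rw [← h7]
          gcongr
      _ = Real.exp (Real.log n + (2 * d + (d + -(η ^ 2 / 16) * m))) := by
          simp only [Real.exp_add]
      _ ≤ _ := by
          apply Real.exp_le_exp.2
          have : 0 ≤ Real.log n := Real.log_nonneg hnR
          linarith
  have hcompl : 1 - Real.exp (-(η ^ 2 / 32) * m) ≤ μ.real Badᶜ := by
    rw [probReal_compl_eq_one_sub hBadm]
    linarith
  refine (ENNReal.ofReal_le_ofReal hcompl).trans ?_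
  rw [ofReal_measureReal]
  refine measure_mono fun ω hω => ?_
  simp only [Bad, B, Set.mem_compl_iff, Set.mem_iUnion, Finset.mem_univ, Set.mem_ofPred_eq,
    not_exists, not_le] at hω
  intro S _
  have hF : frobNorm S ^ 2 = ∑ i, ∑ l, S i l ^ 2 := by
    rw [frobNorm, Real.sq_sqrt (by positivity)]
  have hrow : ∀ i, |∑ j, ((X i ω).mulVec (S i)) j ^ 2 - ∑ l, S i l ^ 2| ≤ δ * ∑ l, S i l ^ 2 := by
    intro i
    have := aux_ext d m N hN1 hNcov (X i ω) η (fun y hy => (hω i trivial y hy).le) (S i)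
    have e : 32 * η = δ := by rw [hη]; ring
    rwa [e] at this
  rw [hF, Finset.mul_sum, Finset.mul_sum]
  constructor
  · refine Finset.sum_le_sum fun i _ => ?_
    have := (abs_le.1 (hrow i)).1
    linarith
  · refine Finset.sum_le_sum fun i _ => ?_
    have := (abs_le.1 (hrow i)).2
    linarith
end

section
/- Let n, d, k be positive integers with k ≤ min(n,d) and let δ ∈ [0,1). Let Ŵ* ∈ ℝ^{n×k} have orthonormal columns, let B̂*, B̂_t ∈ ℝ^{d×k} each have orthonormal columns, let Σ* be a k×k real matrix, and set M* := Ŵ* Σ* B̂*ᵀ. Suppose F ∈ ℝ^{n×k} satisfies ‖F‖_F ≤ (δ/(1−δ))·‖Σ*‖₂·dist(B̂_t, B̂*), and define W := M* B̂_t − F. Then ‖W B̂_tᵀ − M*‖_F ≤ (√k/(1−δ))·‖Σ*‖₂·dist(B̂_t, B̂*). -/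
open Matrix MeasureTheory ProbabilityTheory
open scoped RealInnerProductSpace BigOperators

lemma aux_nonneg {m n : ℕ} (M : Matrix (Fin m) (Fin n) ℝ) : 0 ≤ ∑ i, ∑ j, M i j ^ 2 :=
  Finset.sum_nonneg fun _ _ => Finset.sum_nonneg fun _ _ => sq_nonneg _

lemma frob_trace {m n : ℕ} (M : Matrix (Fin m) (Fin n) ℝ) :
    frobNorm M = Real.sqrt (Matrix.trace (M * Mᵀ)) := by
  simp [frobNorm, Matrix.trace, Matrix.mul_apply, sq]

lemma frob_transpose {m n : ℕ} (M : Matrix (Fin m) (Fin n) ℝ) :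
    frobNorm Mᵀ = frobNorm M := by
  rw [frob_trace, frob_trace, Matrix.transpose_transpose, Matrix.trace_mul_comm]

lemma frob_mul_orth {m n d : ℕ} (M : Matrix (Fin m) (Fin n) ℝ) (B : Matrix (Fin d) (Fin n) ℝ)
    (hB : Bᵀ * B = 1) : frobNorm (M * Bᵀ) = frobNorm M := by
  rw [frob_trace, frob_trace, Matrix.transpose_mul, Matrix.transpose_transpose, Matrix.mul_assoc,
    ← Matrix.mul_assoc Bᵀ, hB, Matrix.one_mul]

lemma frob_orth_mul {m n d : ℕ} (M : Matrix (Fin m) (Fin n) ℝ) (B : Matrix (Fin d) (Fin m) ℝ)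
    (hB : Bᵀ * B = 1) : frobNorm (B * M) = frobNorm M := by
  rw [← frob_transpose, Matrix.transpose_mul, frob_mul_orth _ _ hB, frob_transpose]

lemma spec_nonneg {m n : ℕ} (M : Matrix (Fin m) (Fin n) ℝ) : 0 ≤ specNorm M := norm_nonneg _

lemma spec_transpose {m n : ℕ} (M : Matrix (Fin m) (Fin n) ℝ) : specNorm Mᵀ = specNorm M := by
  have h := Matrix.l2_opNorm_conjTranspose M
  rw [Matrix.conjTranspose_eq_transpose_of_trivial, Matrix.l2_opNorm_def, Matrix.l2_opNorm_def] at h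
  exact h

lemma spec_mulVec {m n : ℕ} (M : Matrix (Fin m) (Fin n) ℝ) (v : Fin n → ℝ) :
    ∑ i, (M *ᵥ v) i ^ 2 ≤ specNorm M ^ 2 * ∑ j, v j ^ 2 := by
  have h := (LinearMap.toContinuousLinearMap (Matrix.toEuclideanLin M)).le_opNorm (WithLp.toLp 2 v)
  have h2 := pow_le_pow_left₀ (norm_nonneg _) h 2
  rw [mul_pow, EuclideanSpace.norm_sq_eq, EuclideanSpace.norm_sq_eq] at h2
  simpa [specNorm] using h2

lemma frob_mul_le {m n d : ℕ} (A : Matrix (Fin m) (Fin n) ℝ) (D : Matrix (Fin n) (Fin d) ℝ) :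
    frobNorm (A * D) ≤ specNorm A * frobNorm D := by
  unfold frobNorm
  apply Real.sqrt_le_iff.mpr
  refine ⟨mul_nonneg (spec_nonneg _) (Real.sqrt_nonneg _), ?_⟩
  rw [mul_pow, Real.sq_sqrt (aux_nonneg D), Finset.sum_comm, Finset.sum_comm (γ := Fin n),
    Finset.mul_sum]
  exact Finset.sum_le_sum fun j _ => spec_mulVec A (fun i => D i j)

lemma frob_le_spec {m n : ℕ} (D : Matrix (Fin m) (Fin n) ℝ) :
    frobNorm D ≤ Real.sqrt m * specNorm D := by
  have h := frob_mul_le Dᵀ (1 : Matrix (Fin m) (Fin m) ℝ)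
  rw [Matrix.mul_one, frob_transpose, spec_transpose, frob_trace 1] at h
  simpa [mul_comm] using h

section
attribute [local instance] Matrix.frobeniusNormedAddCommGroup
lemma frob_sub_le {m n : ℕ} (A B : Matrix (Fin m) (Fin n) ℝ) :
    frobNorm (A - B) ≤ frobNorm A + frobNorm B := by
  have key : ∀ M : Matrix (Fin m) (Fin n) ℝ, frobNorm M = ‖M‖ := by
    intro M
    rw [Matrix.frobenius_norm_def, frobNorm, Real.sqrt_eq_rpow]
    simp
  rw [key, key, key]
  exact norm_sub_le A B
end

theorem stmt14 {n d k : ℕ} (hn : 0 < n) (hd : 0 < d) (hk : 0 < k)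
    (hkn : k ≤ n) (hkd : k ≤ d)
    (δ : ℝ) (hδ0 : 0 ≤ δ) (hδ1 : δ < 1)
    (Wstar : Matrix (Fin n) (Fin k) ℝ) (hWstar : Wstarᵀ * Wstar = 1)
    (Bstar Bt : Matrix (Fin d) (Fin k) ℝ)
    (hBstar : Bstarᵀ * Bstar = 1) (hBt : Btᵀ * Bt = 1)
    (Sig : Matrix (Fin k) (Fin k) ℝ)
    (F : Matrix (Fin n) (Fin k) ℝ)
    (hF : frobNorm F ≤ (δ / (1 - δ)) * specNorm Sig * pdist Bt Bstar) :
    frobNorm ((Wstar * Sig * Bstarᵀ * Bt - F) * Btᵀ - Wstar * Sig * Bstarᵀ) ≤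
      (Real.sqrt k / (1 - δ)) * specNorm Sig * pdist Bt Bstar := by
  have e : (Wstar * Sig * Bstarᵀ * Bt - F) * Btᵀ - Wstar * Sig * Bstarᵀ
      = Wstar * (Sig * (Bstarᵀ * (Bt * Btᵀ - 1))) - F * Btᵀ := by
    simp only [Matrix.sub_mul, Matrix.mul_sub, Matrix.mul_assoc, Matrix.mul_one]
    abel
  have h1 := frob_sub_le (Wstar * (Sig * (Bstarᵀ * (Bt * Btᵀ - 1)))) (F * Btᵀ)
  rw [← e, frob_orth_mul _ _ hWstar, frob_mul_orth _ _ hBt] at h1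
  have h2 := frob_mul_le Sig (Bstarᵀ * (Bt * Btᵀ - 1))
  have h3 : frobNorm (Bstarᵀ * (Bt * Btᵀ - 1)) ≤ Real.sqrt k * pdist Bt Bstar :=
    frob_le_spec _
  have hs := spec_nonneg Sig
  have hp : 0 ≤ pdist Bt Bstar := spec_nonneg _
  have h4 := mul_le_mul_of_nonneg_left h3 hs
  have hk1 : 1 ≤ Real.sqrt k := Real.one_le_sqrt.mpr (by exact_mod_cast hk)
  have hd' : 0 < 1 - δ := by linarith
  have h5 : Real.sqrt k + δ / (1 - δ) ≤ Real.sqrt k / (1 - δ) := by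
    rw [le_div_iff₀ hd', add_mul, div_mul_cancel₀ _ hd'.ne']
    nlinarith
  have h6 := mul_le_mul_of_nonneg_right h5 (mul_nonneg hs hp)
  nlinarith
end

section
/- Let n, d, k be positive integers with k ≤ min(n,d) and let δ ∈ [0, 1/5]. Let W* ∈ ℝ^{n×k}, and let B̂, B̂* ∈ ℝ^{d×k} each have orthonormal columns. Suppose F ∈ ℝ^{n×k} satisfies ‖F‖_F ≤ (δ/(1−δ))·‖W*‖₂·dist(B̂, B̂*), that σ_min²(W*) ≥ (5/2)·δ·‖W*‖₂², and define W := W* B̂*ᵀ B̂ − F. Then ‖W B̂ᵀ − W* B̂*ᵀ‖_F² ≥ ( σ_min²(W*) − (5/2)·δ·‖W*‖₂² ) · dist²(B̂, B̂*), where σ_min(W*) denotes the smallest singular value of W*. -/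
open Matrix MeasureTheory ProbabilityTheory
open scoped RealInnerProductSpace BigOperators

/-- Square of the smallest singular value of an `n × k` real matrix `W`,
i.e. the smallest eigenvalue of `Wᵀ W`. -/
noncomputable def sigMinSq {n k : ℕ} (W : Matrix (Fin n) (Fin k) ℝ) : ℝ :=
  sInf (spectrum ℝ (Wᵀ * W))

lemma aux_frob {m n : ℕ} (M : Matrix (Fin m) (Fin n) ℝ) :
    frobNorm M ^ 2 = (M * Mᵀ).trace := by
  unfold frobNorm
  rw [Real.sq_sqrt (by positivity)]
  simp [Matrix.trace, Matrix.mul_apply, pow_two]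

lemma aux_frobT {m n : ℕ} (M : Matrix (Fin m) (Fin n) ℝ) :
    frobNorm M ^ 2 = (Mᵀ * M).trace := by
  rw [aux_frob, Matrix.trace_mul_comm]

lemma aux_spec {m n : ℕ} (M : Matrix (Fin m) (Fin n) ℝ) : specNorm M ≤ frobNorm M := by
  unfold specNorm
  refine ContinuousLinearMap.opNorm_le_bound _ (Real.sqrt_nonneg _) fun x => ?_
  rw [EuclideanSpace.norm_eq, EuclideanSpace.norm_eq, frobNorm, ← Real.sqrt_mul (by positivity)]
  apply Real.sqrt_le_sqrt
  rw [Finset.sum_mul]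
  refine Finset.sum_le_sum fun i _ => ?_
  have := Finset.sum_mul_sq_le_sq_mul_sq Finset.univ (fun j => M i j) (fun j => x j)
  simpa [Matrix.toLpLin_apply, Matrix.mulVec, dotProduct] using this

lemma aux_psd {n k : ℕ} (W : Matrix (Fin n) (Fin k) ℝ) :
    (Wᵀ * W - algebraMap ℝ _ (sigMinSq W)).PosSemidef := by
  have hA : (Wᵀ * W).IsHermitian := by
    simp [Matrix.IsHermitian, Matrix.conjTranspose_eq_transpose_of_trivial]
  have hH : (Wᵀ * W - algebraMap ℝ (Matrix (Fin k) (Fin k) ℝ) (sigMinSq W)).IsHermitian := by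
    apply hA.sub
    simp [Matrix.IsHermitian, Matrix.algebraMap_eq_diagonal]
  rw [hH.posSemidef_iff_eigenvalues_nonneg]
  intro i
  have h1 : hH.eigenvalues i ∈ spectrum ℝ (Wᵀ * W - algebraMap ℝ _ (sigMinSq W)) := by
    rw [hH.spectrum_real_eq_range_eigenvalues]; exact ⟨i, rfl⟩
  have h2 : hH.eigenvalues i + sigMinSq W ∈ spectrum ℝ (Wᵀ * W) := by
    rw [spectrum.mem_iff] at h1 ⊢
    convert h1 using 2
    rw [map_add]; abel
  have h3 : sigMinSq W ≤ hH.eigenvalues i + sigMinSq W := by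
    refine csInf_le ?_ h2
    rw [hA.spectrum_real_eq_range_eigenvalues]
    exact (Set.finite_range _).bddBelow
  simpa using h3

lemma aux_low {n k d : ℕ} (W : Matrix (Fin n) (Fin k) ℝ) (M : Matrix (Fin k) (Fin d) ℝ) :
    sigMinSq W * frobNorm M ^ 2 ≤ frobNorm (W * M) ^ 2 := by
  have h := ((aux_psd W).conjTranspose_mul_mul_same M).trace_nonneg
  rw [aux_frobT, aux_frobT]
  rw [Matrix.conjTranspose_eq_transpose_of_trivial, Matrix.mul_sub, Matrix.sub_mul,
    Matrix.trace_sub, Algebra.algebraMap_eq_smul_one, Matrix.mul_smul, Matrix.smul_mul,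
    Matrix.trace_smul, Matrix.mul_one, smul_eq_mul] at h
  rw [Matrix.transpose_mul]
  simp only [Matrix.mul_assoc] at h ⊢
  linarith

theorem stmt15 {n d k : ℕ} (hn : 0 < n) (hd : 0 < d) (hk : 0 < k)
    (hkn : k ≤ n) (hkd : k ≤ d)
    (δ : ℝ) (hδ0 : 0 ≤ δ) (hδ1 : δ ≤ 1 / 5)
    (Wstar : Matrix (Fin n) (Fin k) ℝ)
    (Bhat Bstar : Matrix (Fin d) (Fin k) ℝ)
    (hBhat : Bhatᵀ * Bhat = 1) (hBstar : Bstarᵀ * Bstar = 1)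
    (F : Matrix (Fin n) (Fin k) ℝ)
    (hF : frobNorm F ≤ (δ / (1 - δ)) * specNorm Wstar * pdist Bhat Bstar)
    (hσ : (5 / 2 : ℝ) * δ * specNorm Wstar ^ 2 ≤ sigMinSq Wstar) :
    (sigMinSq Wstar - (5 / 2 : ℝ) * δ * specNorm Wstar ^ 2) * pdist Bhat Bstar ^ 2 ≤
      frobNorm ((Wstar * Bstarᵀ * Bhat - F) * Bhatᵀ - Wstar * Bstarᵀ) ^ 2 := by
  have hsig : 0 ≤ sigMinSq Wstar := le_trans (by positivity) hσ
  set M := Bstarᵀ * (Bhat * Bhatᵀ - 1) with hM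
  have hMB : M * Bhat = 0 := by
    rw [hM, Matrix.mul_assoc, Matrix.sub_mul, Matrix.mul_assoc, hBhat]; simp
  have hN : (Wstar * Bstarᵀ * Bhat - F) * Bhatᵀ - Wstar * Bstarᵀ = Wstar * M - F * Bhatᵀ := by
    rw [hM]
    simp only [Matrix.mul_sub, Matrix.sub_mul, Matrix.mul_assoc, Matrix.mul_one]
    abel
  have hBM : Bhatᵀ * Mᵀ = 0 := by rw [← Matrix.transpose_mul, hMB, Matrix.transpose_zero]
  have hsplit : frobNorm (Wstar * M - F * Bhatᵀ) ^ 2 = frobNorm (Wstar * M) ^ 2 + frobNorm F ^ 2 := by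
    rw [aux_frob, aux_frob, aux_frob, ← Matrix.trace_add]
    congr 1
    have e1 : Wstar * M * (Bhat * Fᵀ) = 0 := by
      rw [Matrix.mul_assoc, ← Matrix.mul_assoc M, hMB]; simp
    have e2 : F * Bhatᵀ * (Mᵀ * Wstarᵀ) = 0 := by
      rw [Matrix.mul_assoc, ← Matrix.mul_assoc Bhatᵀ, hBM]; simp
    have e3 : F * Bhatᵀ * (Bhat * Fᵀ) = F * Fᵀ := by
      rw [Matrix.mul_assoc, ← Matrix.mul_assoc Bhatᵀ, hBhat]; simp
    rw [Matrix.transpose_sub, Matrix.transpose_mul Wstar M, Matrix.transpose_mul F Bhatᵀ,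
      Matrix.transpose_transpose, Matrix.sub_mul, Matrix.mul_sub, Matrix.mul_sub, e1, e2, e3]
    abel
  have hp : pdist Bhat Bstar ^ 2 ≤ frobNorm M ^ 2 :=
    pow_le_pow_left₀ (norm_nonneg _) (aux_spec M) 2
  rw [hN, hsplit]
  have h1 := aux_low Wstar M
  have h2 := mul_le_mul_of_nonneg_left hp hsig
  have h3 : 0 ≤ (5 / 2 : ℝ) * δ * specNorm Wstar ^ 2 * pdist Bhat Bstar ^ 2 := by positivity
  nlinarith [sq_nonneg (frobNorm F)]
end
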